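/- arXiv:2111.05225 — 7 statements merged into one kernel-verified Lean document; each statement's English description precedes it below -/
import Mathlib

section
/- Let d, k ∈ ℕ with d ≥ 1, and let P_k := [0, 2k+1]^d ⊆ ℝ^d. Let S_1, …, S_{2k} be generalized split sets in ℝ^d. Then P_k is not contained in ⋃_{i=1}^{2k} cl(S_i), where cl(X) denotes the topological closure of X. -/
/-- A generalized split (g-split) set in `ℝ^n` is a set of the form
`{x : β < ⟨α, x⟩ < β + 1}` for some `α ∈ ℤ^n \ {0}` and `β ∈ ℝ`. -/
def IsGSplit {n : ℕ} (S : Set (Fin n → ℝ)) : Prop :=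
  ∃ (α : Fin n → ℤ) (β : ℝ), α ≠ 0 ∧
    S = {x : Fin n → ℝ |
      β < ∑ i, (α i : ℝ) * x i ∧ ∑ i, (α i : ℝ) * x i < β + 1}

/-- Two points of the closure of a g-split set that agree off a suitable coordinate `j` are at
distance at most `1` in that coordinate. -/
theorem IsGSplit.exists_coord_abs_sub_le_one {n : ℕ} {S : Set (Fin n → ℝ)} (hS : IsGSplit S) :
    ∃ j, ∀ x ∈ closure S, ∀ y ∈ closure S, (∀ i, i ≠ j → x i = y i) → |x j - y j| ≤ 1 := by
  obtain ⟨α, β, hα, rfl⟩ := hS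
  obtain ⟨j, hj⟩ := Function.ne_iff.mp hα
  have hclosure : closure {x : Fin n → ℝ |
      β < ∑ i, (α i : ℝ) * x i ∧ ∑ i, (α i : ℝ) * x i < β + 1} ⊆
      {x | β ≤ ∑ i, (α i : ℝ) * x i ∧ ∑ i, (α i : ℝ) * x i ≤ β + 1} := by
    refine closure_minimal (fun x hx => ⟨hx.1.le, hx.2.le⟩) ?_
    have hcont : Continuous fun x : Fin n → ℝ => ∑ i, (α i : ℝ) * x i := by fun_prop
    exact (isClosed_le continuous_const hcont).inter (isClosed_le hcont continuous_const)
  refine ⟨j, fun x hx y hy hxy => ?_⟩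
  obtain ⟨hx₁, hx₂⟩ := hclosure hx
  obtain ⟨hy₁, hy₂⟩ := hclosure hy
  have hsub : ∑ i, (α i : ℝ) * x i - ∑ i, (α i : ℝ) * y i = α j * (x j - y j) := by
    rw [← Finset.sum_sub_distrib, Finset.sum_eq_single j]
    · ring
    · intro i _ hi
      rw [hxy i hi, sub_self]
    · simp
  have hprod : |(α j : ℝ)| * |x j - y j| ≤ 1 := by
    rw [← abs_mul, ← hsub, abs_le]
    constructor <;> linarith
  have hone : (1 : ℝ) ≤ |(α j : ℝ)| := by
    exact_mod_cast Int.one_le_abs hj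
  nlinarith [abs_nonneg (x j - y j)]

/-- A set of functions that are determined by their values off `j` has density at most
`1 / card κ`. -/
theorem Finset.card_mul_card_le_of_eq_of_eq_off {ι κ : Type*} [Fintype ι] [DecidableEq ι]
    [Fintype κ] (A : Finset (ι → κ)) (j : ι)
    (hA : ∀ f ∈ A, ∀ g ∈ A, (∀ i, i ≠ j → f i = g i) → f = g) :
    A.card * Fintype.card κ ≤ Fintype.card (ι → κ) := by
  rw [← Finset.card_univ (α := κ), ← Finset.card_product, ← Finset.card_univ]
  refine Finset.card_le_card_of_injOn (fun p => Function.update p.1 j p.2)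
    (fun _ _ => Finset.mem_coe.mpr (Finset.mem_univ _)) ?_
  rintro ⟨f, s⟩ hf ⟨g, t⟩ hg h
  have hf' : f ∈ A := (Finset.mem_product.mp hf).1
  have hg' : g ∈ A := (Finset.mem_product.mp hg).1
  have hst : s = t := by simpa using congrFun h j
  have hfg : f = g := hA f hf' g hg' fun i hi => by
    simpa [hi] using congrFun h i
  rw [hst, hfg]

theorem stmt4 (d k : ℕ) (hd : 1 ≤ d)
    (S : Fin (2 * k) → Set (Fin d → ℝ)) (hS : ∀ i, IsGSplit (S i)) :
    ¬ (Set.Icc (0 : Fin d → ℝ) (fun _ => (2 * k + 1 : ℝ)) ⊆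
        ⋃ i, closure (S i)) := by
  classical
  intro hcover
  -- A grid of `2k + 1` equally spaced values in `[0, 2k + 1]`, with gaps larger than `1`.
  let p : (Fin d → Fin (2 * k + 1)) → Fin d → ℝ :=
    fun f i => (f i : ℝ) * ((2 * k + 1) / (2 * k))
  have hp : ∀ f, p f ∈ Set.Icc (0 : Fin d → ℝ) (fun _ => (2 * k + 1 : ℝ)) := by
    intro f
    refine ⟨fun i => by simp only [p, Pi.zero_apply]; positivity, fun i => ?_⟩
    have hfi : (f i : ℝ) ≤ 2 * k := by exact_mod_cast Nat.lt_succ_iff.mp (f i).2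
    calc (f i : ℝ) * ((2 * k + 1) / (2 * k)) = (f i : ℝ) / (2 * k) * (2 * k + 1) := by ring
      _ ≤ 1 * (2 * k + 1) := by
        gcongr
        exact div_le_one_of_le₀ hfi (by positivity)
      _ = 2 * k + 1 := one_mul _
  let A : Fin (2 * k) → Finset (Fin d → Fin (2 * k + 1)) :=
    fun m => Finset.univ.filter fun f => p f ∈ closure (S m)
  have hA : ∀ m, (A m).card * (2 * k + 1) ≤ Fintype.card (Fin d → Fin (2 * k + 1)) := by
    intro m
    obtain ⟨j, hj⟩ := (hS m).exists_coord_abs_sub_le_one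
    have hcard := Finset.card_mul_card_le_of_eq_of_eq_off (A m) j ?_
    · rwa [Fintype.card_fin] at hcard
    intro f hf g hg hfg
    have hdist := hj (p f) (Finset.mem_filter.mp hf).2 (p g) (Finset.mem_filter.mp hg).2
      fun i hi => by simp only [p, hfg i hi]
    have hfgj : f j = g j := by
      by_contra hne
      have hk : (0 : ℝ) < 2 * k := by exact_mod_cast m.pos
      have hgap : (1 : ℝ) < (2 * k + 1) / (2 * k) := by
        rw [one_lt_div hk]
        linarith
      have hint : (1 : ℝ) ≤ |(f j : ℝ) - (g j : ℝ)| := by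
        have : (1 : ℤ) ≤ |((f j : ℕ) : ℤ) - ((g j : ℕ) : ℤ)| :=
          Int.one_le_abs (by omega)
        exact_mod_cast this
      rw [← sub_mul, abs_mul, abs_of_pos (zero_lt_one.trans hgap)] at hdist
      nlinarith
    funext i
    by_cases hi : i = j
    · rw [hi, hfgj]
    · exact hfg i hi
  have huniv : Finset.univ ⊆ Finset.univ.biUnion A := by
    intro f _
    obtain ⟨m, hm⟩ := Set.mem_iUnion.mp (hcover (hp f))
    exact Finset.mem_biUnion.mpr
      ⟨m, Finset.mem_univ m, Finset.mem_filter.mpr ⟨Finset.mem_univ f, hm⟩⟩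
  have hcount : Fintype.card (Fin d → Fin (2 * k + 1)) * (2 * k + 1) ≤
      2 * k * Fintype.card (Fin d → Fin (2 * k + 1)) :=
    calc Fintype.card (Fin d → Fin (2 * k + 1)) * (2 * k + 1)
        ≤ (∑ m, (A m).card) * (2 * k + 1) :=
          Nat.mul_le_mul_right _ ((Finset.card_le_card huniv).trans Finset.card_biUnion_le)
      _ = ∑ m, (A m).card * (2 * k + 1) := Finset.sum_mul _ _ _
      _ ≤ ∑ _m : Fin (2 * k), Fintype.card (Fin d → Fin (2 * k + 1)) :=
          Finset.sum_le_sum fun m _ => hA m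
      _ = 2 * k * Fintype.card (Fin d → Fin (2 * k + 1)) := by simp
  have hpos : 0 < Fintype.card (Fin d → Fin (2 * k + 1)) := Fintype.card_pos
  nlinarith
end

section
/- Let n ≥ 2 and let S_1, …, S_{2n} be split sets in ℝ^n each having nonempty intersection with the hyperplane {x ∈ ℝ^n : x_n = 2n+1}. Then the face [0, 2n+1]^{n−1} × {2n+1} of the box is not contained in ⋃_{i=1}^{2n} cl(S_i), where cl(X) denotes the topological closure of X. -/
/-- A split set in `ℝ^n` is a set of the form `{x : β < ⟨α, x⟩ < β + 1}` for some
`α ∈ ℤ^n \ {0}` and `β ∈ ℤ`. -/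
def IsSplit {n : ℕ} (S : Set (Fin n → ℝ)) : Prop :=
  ∃ (α : Fin n → ℤ) (β : ℤ), α ≠ 0 ∧
    S = {x : Fin n → ℝ |
      (β : ℝ) < ∑ i, (α i : ℝ) * x i ∧ ∑ i, (α i : ℝ) * x i < (β : ℝ) + 1}

/-- Fewer than `m` subsets of a grid `ι → Fin m`, each meeting every line in some coordinate
direction at most once, do not cover the grid. -/
theorem exists_forall_notMem_of_card_lt {ι κ : Type*} [Fintype ι] [Fintype κ] {m : ℕ}
    (hm : Fintype.card κ < m) (B : κ → Set (ι → Fin m))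
    (hB : ∀ i, ∃ c, ∀ f ∈ B i, ∀ g ∈ B i, (∀ j, j ≠ c → f j = g j) → f = g) :
    ∃ f, ∀ i, f ∉ B i := by
  classical
  by_contra! h
  rcases isEmpty_or_nonempty κ with hκ | ⟨⟨i₀⟩⟩
  · obtain ⟨i, -⟩ := h fun _ => ⟨0, by lia⟩
    exact hκ.elim i
  obtain ⟨c₀, -⟩ := hB i₀
  have hι : 0 < Fintype.card ι := Fintype.card_pos_iff.2 ⟨c₀⟩
  have hcard : ∀ i ∈ (Finset.univ : Finset κ),
      (Finset.univ.filter (· ∈ B i)).card ≤ m ^ (Fintype.card ι - 1) := by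
    intro i _
    obtain ⟨c, hc⟩ := hB i
    have hle := Finset.card_le_card_of_injOn (s := Finset.univ.filter (· ∈ B i))
      (t := (Finset.univ : Finset ({j // j ≠ c} → Fin m))) (fun f j => f j) (by simp)
      (by
        intro f hf g hg hfg
        simp only [Finset.coe_filter, Finset.mem_univ, true_and, Set.mem_ofPred_eq] at hf hg
        exact hc f hf g hg fun j hj => congrFun hfg ⟨j, hj⟩)
    simpa [Fintype.card_subtype_compl] using hle
  have hunion := Finset.card_biUnion_le_card_mul _ _ _ hcard
  have huniv : (Finset.univ : Finset κ).biUnion (fun i => Finset.univ.filter (· ∈ B i)) =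
      Finset.univ := by
    ext f
    simpa using h f
  rw [huniv] at hunion
  simp only [Finset.card_univ, Fintype.card_pi, Fintype.card_fin, Finset.prod_const] at hunion
  rw [← Nat.sub_add_cancel hι, pow_succ, Nat.add_sub_cancel, mul_comm] at hunion
  exact absurd (Nat.le_of_mul_le_mul_right hunion (pow_pos (by lia) _)) (by lia)

/-- Two points of a closed slab `b ≤ ⟨α, x⟩ ≤ b + 1` with `α` integral that differ only in a
coordinate `c` with `α c ≠ 0` are at distance at most one in that coordinate. -/
theorem abs_sub_le_one_of_slab {ι : Type*} [Fintype ι] {α : ι → ℤ} {b : ℝ} {c : ι}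
    (hc : α c ≠ 0) {x y : ι → ℝ} (hxy : ∀ j, j ≠ c → x j = y j)
    (hx : b ≤ ∑ i, (α i : ℝ) * x i ∧ ∑ i, (α i : ℝ) * x i ≤ b + 1)
    (hy : b ≤ ∑ i, (α i : ℝ) * y i ∧ ∑ i, (α i : ℝ) * y i ≤ b + 1) :
    |x c - y c| ≤ 1 := by
  have hdiff : ∑ i, (α i : ℝ) * x i - ∑ i, (α i : ℝ) * y i = α c * (x c - y c) := by
    rw [← Finset.sum_sub_distrib, Finset.sum_eq_single c]
    · ring
    · intro j _ hj
      rw [hxy j hj, sub_self]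
    · simp
  have hle : |(α c : ℝ) * (x c - y c)| ≤ 1 := by
    rw [← hdiff, abs_le]
    constructor <;> linarith [hx.1, hx.2, hy.1, hy.2]
  have hone : (1 : ℝ) ≤ |(α c : ℝ)| := by
    exact_mod_cast Int.one_le_abs hc
  rw [abs_mul] at hle
  nlinarith [abs_nonneg (x c - y c)]

/-- The normal vector of a split set meeting a hyperplane `x l = z` with `z` an integer has a
nonzero coordinate other than `l`; the closure of the split set lies in the closed slab. -/
theorem IsSplit.exists_slab {n : ℕ} {S : Set (Fin n → ℝ)} (hS : IsSplit S) {l : Fin n} {z : ℤ}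
    (hmeet : (S ∩ {x : Fin n → ℝ | x l = z}).Nonempty) :
    ∃ (α : Fin n → ℤ) (b : ℝ) (c : Fin n), c ≠ l ∧ α c ≠ 0 ∧ ∀ x ∈ closure S,
      b ≤ ∑ i, (α i : ℝ) * x i ∧ ∑ i, (α i : ℝ) * x i ≤ b + 1 := by
  obtain ⟨α, β, -, rfl⟩ := hS
  obtain ⟨x, ⟨hx₁, hx₂⟩, hxl⟩ := hmeet
  have hc : ∃ c, c ≠ l ∧ α c ≠ 0 := by
    by_contra! h
    have hsum : ∑ i, (α i : ℝ) * x i = ((α l * z : ℤ) : ℝ) := by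
      rw [Finset.sum_eq_single l]
      · rw [show x l = z from hxl]
        push_cast
        rfl
      · intro j _ hj
        simp [h j hj]
      · simp
    rw [hsum] at hx₁ hx₂
    have h₁ : β < α l * z := by exact_mod_cast hx₁
    have h₂ : α l * z < β + 1 := by exact_mod_cast hx₂
    lia
  obtain ⟨c, hcl, hc⟩ := hc
  refine ⟨α, β, c, hcl, hc, fun y hy => ?_⟩
  have hclosed : IsClosed {x : Fin n → ℝ |
      (β : ℝ) ≤ ∑ i, (α i : ℝ) * x i ∧ ∑ i, (α i : ℝ) * x i ≤ (β : ℝ) + 1} := by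
    rw [Set.ofPred_and]
    exact (isClosed_le (by fun_prop) (by fun_prop)).inter (isClosed_le (by fun_prop) (by fun_prop))
  exact closure_minimal (Set.ofPred_subset_ofPred.2 fun x hx => ⟨hx.1.le, hx.2.le⟩) hclosed hy

theorem stmt6 (n : ℕ) (hn : 2 ≤ n)
    (S : Fin (2 * n) → Set (Fin n → ℝ)) (hS : ∀ i, IsSplit (S i))
    (hmeet : ∀ i, (S i ∩ {x : Fin n → ℝ | x ⟨n - 1, by omega⟩ = 2 * n + 1}).Nonempty) :
    ¬ ({x : Fin n → ℝ | (∀ j : Fin n, 0 ≤ x j ∧ x j ≤ 2 * n + 1) ∧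
          x ⟨n - 1, by omega⟩ = 2 * n + 1} ⊆
        ⋃ i, closure (S i)) := by
  intro hcover
  set l : Fin n := ⟨n - 1, by omega⟩
  have hn₀ : (0 : ℝ) < 2 * n := by
    have : 0 < n := by lia
    positivity
  -- The grid with `2n + 1` equally spaced points along each edge has spacing larger than one.
  set s : ℝ := (2 * n + 1) / (2 * n) with hs
  have hs₁ : 1 < s := by
    rw [hs, one_lt_div hn₀]
    linarith
  have hs₂ : 2 * n * s = 2 * n + 1 := by
    rw [hs]
    field_simp
  let p : (Fin n → Fin (2 * n + 1)) → Fin n → ℝ :=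
    fun f j => if j = l then 2 * n + 1 else (f j : ℕ) * s
  obtain ⟨f, hf⟩ := exists_forall_notMem_of_card_lt (m := 2 * n + 1) (by simp)
    (fun i => {f | p f ∈ closure (S i)}) (by
      intro i
      obtain ⟨α, b, c, hcl, hc, hslab⟩ := (hS i).exists_slab (l := l) (z := 2 * n + 1)
        (by push_cast; exact hmeet i)
      refine ⟨c, fun f hf g hg hfg => ?_⟩
      have hdist := abs_sub_le_one_of_slab hc
        (fun j hj => by simp only [p, hfg j hj]) (hslab _ hf) (hslab _ hg)
      simp only [p, if_neg hcl, ← sub_mul, abs_mul, abs_of_pos (one_pos.trans hs₁)] at hdist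
      funext j
      rcases ne_or_eq j c with hj | rfl
      · exact hfg j hj
      · by_contra hne
        have hz : (1 : ℤ) ≤ |((f j : ℕ) : ℤ) - ((g j : ℕ) : ℤ)| := by
          apply Int.one_le_abs
          have := Fin.val_ne_of_ne hne
          lia
        have hr : (1 : ℝ) ≤ |((f j : ℕ) : ℝ) - ((g j : ℕ) : ℝ)| := by exact_mod_cast hz
        nlinarith)
  have hmem : p f ∈ ⋃ i, closure (S i) := by
    refine hcover ⟨fun j => ?_, by simp [p]⟩
    by_cases hj : j = l
    · simp only [p, if_pos hj]
      constructor <;> linarith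
    · simp only [p, if_neg hj]
      have hle : ((f j : ℕ) : ℝ) ≤ 2 * n := by exact_mod_cast Nat.lt_succ_iff.1 (f j).isLt
      refine ⟨by positivity, ?_⟩
      rw [← hs₂]
      gcongr
  obtain ⟨i, hi⟩ := Set.mem_iUnion.1 hmem
  exact hf i hi
end

section
/- Let n ≥ 2 and ε > 0, and define P' := [0, 2n+1]^{n−1} × (2n+1, 2n+1+ε) ⊆ ℝ^n. Let S_1, …, S_{2n} be split sets in ℝ^n each having nonempty intersection with the hyperplane {x ∈ ℝ^n : x_n = 2n+1}. Then P' is not contained in ⋃_{i=1}^{2n} S_i. -/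
/-- A family of words over `Fin M` that are determined by their letters away from one position `j`
has at most `M ^ (#ι - 1)` members. -/
theorem card_le_of_determined_off {ι : Type*} [Fintype ι] [DecidableEq ι] {M : ℕ}
    (A : Finset (ι → Fin M)) (j : ι)
    (hA : ∀ f ∈ A, ∀ g ∈ A, (∀ k, k ≠ j → f k = g k) → f = g) :
    A.card ≤ M ^ (Fintype.card ι - 1) := by
  have h : A.card ≤ (Finset.univ : Finset ({k : ι // k ≠ j} → Fin M)).card :=
    Finset.card_le_card_of_injOn (fun f k => f k) (fun _ _ => Finset.mem_coe.2 (Finset.mem_univ _))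
      (fun f hf g hg hfg => hA f hf g hg fun k hk => congrFun hfg ⟨k, hk⟩)
  simpa [Fintype.card_subtype_compl] using h

/-- Fewer than `M` families of words over `Fin M`, each determined off one position, do not
exhaust all words. -/
theorem exists_forall_notMem_of_determined_off {ι κ : Type*} [Fintype ι] [DecidableEq ι]
    [Nonempty ι] [Fintype κ] {M : ℕ} (hM : Fintype.card κ < M) (A : κ → Set (ι → Fin M)) (j : κ → ι)
    (hA : ∀ i, ∀ f ∈ A i, ∀ g ∈ A i, (∀ k, k ≠ j i → f k = g k) → f = g) :
    ∃ f, ∀ i, f ∉ A i := by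
  classical
  by_contra! hcov
  have hsub : (Finset.univ : Finset (ι → Fin M)) ⊆
      Finset.univ.biUnion fun i => Finset.univ.filter (· ∈ A i) := by
    intro f _
    simpa using hcov f
  have hcard := (Finset.card_le_card hsub).trans <|
    Finset.card_biUnion_le_card_mul _ _ (M ^ (Fintype.card ι - 1)) fun i _ =>
      card_le_of_determined_off _ (j i) fun f hf g hg =>
        hA i f (Finset.mem_filter.1 hf).2 g (Finset.mem_filter.1 hg).2
  have hpow : M ^ Fintype.card ι = M * M ^ (Fintype.card ι - 1) :=
    (mul_pow_sub_one Fintype.card_ne_zero M).symm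
  simp only [Finset.card_univ, Fintype.card_fun, Fintype.card_fin, hpow] at hcard
  have hpos : 0 < M ^ (Fintype.card ι - 1) := pow_pos (by omega) _
  exact absurd (Nat.le_of_mul_le_mul_right hcard hpos) (by omega)

/-- A split set meeting the hyperplane `x l = m` with `m` an integer has a normal vector with a
nonzero entry away from `l`. -/
theorem exists_ne_of_split_meets {n : ℕ} {α : Fin n → ℤ} {β m : ℤ} {l : Fin n} {x : Fin n → ℝ}
    (hx : x l = m) (h₁ : (β : ℝ) < ∑ i, (α i : ℝ) * x i)
    (h₂ : ∑ i, (α i : ℝ) * x i < (β : ℝ) + 1) : ∃ j, j ≠ l ∧ α j ≠ 0 := by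
  by_contra! h
  have hsum : ∑ i, (α i : ℝ) * x i = α l * m := by
    rw [Finset.sum_eq_single l (fun i _ hi => by simp [h i hi]) (by simp), hx]
  rw [hsum] at h₁ h₂
  norm_cast at h₁ h₂
  omega

/-- Two points of a split set that differ only in coordinate `j`, by an integer, coincide if the
normal vector is nonzero at `j`. -/
theorem eq_of_mem_split {n : ℕ} {α : Fin n → ℤ} {β : ℤ} {j : Fin n} (hα : α j ≠ 0)
    {x y : Fin n → ℝ} {a b : ℤ} (hoff : ∀ k, k ≠ j → x k = y k) (hx : x j = a) (hy : y j = b)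
    (hx₁ : (β : ℝ) < ∑ i, (α i : ℝ) * x i) (hx₂ : ∑ i, (α i : ℝ) * x i < (β : ℝ) + 1)
    (hy₁ : (β : ℝ) < ∑ i, (α i : ℝ) * y i) (hy₂ : ∑ i, (α i : ℝ) * y i < (β : ℝ) + 1) :
    a = b := by
  have hdiff : ∑ i, (α i : ℝ) * x i - ∑ i, (α i : ℝ) * y i = ((α j * (a - b) : ℤ) : ℝ) := by
    rw [← Finset.sum_sub_distrib,
      Finset.sum_eq_single j (fun i _ hi => by simp [hoff i hi]) (by simp), hx, hy]
    push_cast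
    ring
  have hlt : α j * (a - b) < 1 := by
    have : ((α j * (a - b) : ℤ) : ℝ) < 1 := by linarith
    exact_mod_cast this
  have hgt : -1 < α j * (a - b) := by
    have : (-1 : ℝ) < ((α j * (a - b) : ℤ) : ℝ) := by linarith
    exact_mod_cast this
  have hzero : α j * (a - b) = 0 := by omega
  exact sub_eq_zero.1 ((mul_eq_zero.1 hzero).resolve_left hα)

theorem stmt7 (n : ℕ) (hn : 2 ≤ n) (ε : ℝ) (hε : 0 < ε)
    (S : Fin (2 * n) → Set (Fin n → ℝ)) (hS : ∀ i, IsSplit (S i))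
    (hmeet : ∀ i, (S i ∩ {x : Fin n → ℝ | x ⟨n - 1, by omega⟩ = 2 * n + 1}).Nonempty) :
    ¬ ({x : Fin n → ℝ | (∀ j : Fin n, (j : ℕ) < n - 1 → 0 ≤ x j ∧ x j ≤ 2 * n + 1) ∧
          2 * n + 1 < x ⟨n - 1, by omega⟩ ∧ x ⟨n - 1, by omega⟩ < 2 * n + 1 + ε} ⊆
        ⋃ i, S i) := by
  intro hcov
  have hlast : n - 1 < n := by omega
  let l : Fin n := ⟨n - 1, hlast⟩
  have : Nonempty (Fin n) := ⟨l⟩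
  choose α β _ hSeq using hS
  have hj : ∀ i, ∃ j, j ≠ l ∧ α i j ≠ 0 := by
    intro i
    obtain ⟨x, hxS, hx⟩ := hmeet i
    rw [hSeq i] at hxS
    exact exists_ne_of_split_meets (m := 2 * n + 1) (by push_cast; exact hx) hxS.1 hxS.2
  choose j hjl hjα using hj
  let p : (Fin n → Fin (2 * n + 1)) → Fin n → ℝ :=
    fun f k => if k = l then 2 * n + 1 + ε / 2 else ((f k : ℕ) : ℝ)
  obtain ⟨f, hf⟩ := exists_forall_notMem_of_determined_off (M := 2 * n + 1) (by simp)
    (fun i => {f | p f ∈ S i}) j (by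
      intro i f hf g hg hfg
      simp only [Set.mem_ofPred_eq, hSeq i] at hf hg
      have hval : ((f (j i) : ℕ) : ℤ) = ((g (j i) : ℕ) : ℤ) :=
        eq_of_mem_split (hjα i) (fun k hk => by simp only [p, hfg k hk])
          (by simp [p, hjl i]) (by simp [p, hjl i]) hf.1 hf.2 hg.1 hg.2
      funext k
      by_cases hk : k = j i
      · subst hk
        exact Fin.ext (by exact_mod_cast hval)
      · exact hfg k hk)
  have hmem : p f ∈ ⋃ i, S i := by
    have hpl : p f l = 2 * n + 1 + ε / 2 := if_pos rfl
    refine hcov ⟨fun k hk => ?_, ?_, ?_⟩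
    · have hkl : k ≠ l := fun h => by simp [h, l] at hk
      have hle : (f k : ℕ) ≤ 2 * n + 1 := (f k).2.le
      simp only [p, if_neg hkl]
      exact ⟨Nat.cast_nonneg _, by exact_mod_cast hle⟩
    · change _ < p f l
      linarith
    · change p f l < _
      linarith
  obtain ⟨i, hi⟩ := Set.mem_iUnion.1 hmem
  exact hf i hi
end

section
/- Let n ≥ 1 and P := [−1/2, 2n + 3/2]^n ⊆ ℝ^n. Then P \ [0, 2n+1]^n ⊆ ⋃_{i=1}^n ( {x ∈ ℝ^n : 2n+1 < x_i < 2n+2} ∪ {x ∈ ℝ^n : −1 < x_i < 0} ). In particular, the set P \ conv(P ∩ ℤ^n) can be covered by 2n split sets, so its split cover number is at most 2n. -/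
/-- An open unit slab between consecutive integers in a coordinate direction is a split set. -/
theorem isSplit_coordinate {n : ℕ} (i : Fin n) (β : ℤ) :
    IsSplit {x : Fin n → ℝ | (β : ℝ) < x i ∧ x i < (β : ℝ) + 1} := by
  refine ⟨Pi.single i 1, β, by simp, ?_⟩
  have h (x : Fin n → ℝ) : ∑ j, ((Pi.single i 1 : Fin n → ℤ) j : ℝ) * x j = x i := by
    simp [Pi.single_apply]
  simp only [h]

/-- The cube `[a, b]^ι` is contained in the convex hull of any set containing its vertices. -/
theorem Icc_subset_convexHull_of_vertices {ι : Type*} [Finite ι] {a b : ℝ} (hab : a ≤ b)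
    {V : Set (ι → ℝ)} (hV : ∀ v : ι → ℝ, (∀ i, v i = a ∨ v i = b) → v ∈ V) :
    Set.Icc (fun _ => a) (fun _ => b) ⊆ convexHull ℝ V := by
  have hbox : Set.Icc (fun _ : ι => a) (fun _ => b) =
      convexHull ℝ (Set.univ.pi fun _ : ι => ({a, b} : Set ℝ)) := by
    simp only [convexHull_pi, convexHull_pair, segment_eq_Icc hab, Set.pi_univ_Icc]
  rw [hbox]
  exact convexHull_mono fun v hv => hV v fun i => hv i (Set.mem_univ i)

/-- A point outside `[0, M]^n` but within distance `1/2` of it in each coordinate has a coordinate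
in one of the open unit intervals adjacent to `[0, M]`. -/
theorem Icc_diff_Icc_subset_iUnion {ι : Type*} {M : ℝ} :
    Set.Icc (fun _ => -(1 / 2 : ℝ)) (fun _ => M + 1 / 2) \
        Set.Icc (0 : ι → ℝ) (fun _ => M) ⊆
      ⋃ i : ι, ({x : ι → ℝ | M < x i ∧ x i < M + 1} ∪ {x : ι → ℝ | -1 < x i ∧ x i < 0}) := by
  rintro x ⟨⟨hl, hu⟩, hx⟩
  by_contra hcover
  simp only [Set.mem_iUnion, Set.mem_union, Set.mem_ofPred_eq, not_exists, not_or, not_and,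
    not_lt] at hcover
  refine hx ⟨fun i => ?_, fun i => ?_⟩
  · exact (hcover i).2 (by linarith [hl i])
  · by_contra! h
    linarith [(hcover i).1 h, hu i]

theorem stmt9 (n : ℕ) (hn : 1 ≤ n) :
    (Set.Icc (fun _ => -(1 / 2 : ℝ)) (fun _ => (2 * n + 3 / 2 : ℝ)) \
        Set.Icc (0 : Fin n → ℝ) (fun _ => (2 * n + 1 : ℝ)) ⊆
      ⋃ i : Fin n,
        ({x : Fin n → ℝ | 2 * n + 1 < x i ∧ x i < 2 * n + 2} ∪
          {x : Fin n → ℝ | -1 < x i ∧ x i < 0})) ∧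
    ∃ 𝒮 : Finset (Set (Fin n → ℝ)), 𝒮.card ≤ 2 * n ∧ (∀ S ∈ 𝒮, IsSplit S) ∧
      Set.Icc (fun _ => -(1 / 2 : ℝ)) (fun _ => (2 * n + 3 / 2 : ℝ)) \
          convexHull ℝ
            (Set.Icc (fun _ => -(1 / 2 : ℝ)) (fun _ => (2 * n + 3 / 2 : ℝ)) ∩
              {x : Fin n → ℝ | ∀ i, ∃ m : ℤ, x i = (m : ℝ)}) ⊆
        ⋃ S ∈ 𝒮, S := by
  have hcover : Set.Icc (fun _ => -(1 / 2 : ℝ)) (fun _ => (2 * n + 3 / 2 : ℝ)) \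
        Set.Icc (0 : Fin n → ℝ) (fun _ => (2 * n + 1 : ℝ)) ⊆
      ⋃ i : Fin n,
        ({x : Fin n → ℝ | 2 * n + 1 < x i ∧ x i < 2 * n + 2} ∪
          {x : Fin n → ℝ | -1 < x i ∧ x i < 0}) := by
    have hP : (2 * n + 3 / 2 : ℝ) = 2 * n + 1 + 1 / 2 := by ring
    have hslab : (2 * n + 2 : ℝ) = 2 * n + 1 + 1 := by ring
    rw [hP, hslab]
    exact Icc_diff_Icc_subset_iUnion
  refine ⟨hcover, ?_⟩
  classical
  let upper (i : Fin n) : Set (Fin n → ℝ) := {x | 2 * n + 1 < x i ∧ x i < 2 * n + 2}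
  let lower (i : Fin n) : Set (Fin n → ℝ) := {x | -1 < x i ∧ x i < 0}
  refine ⟨Finset.univ.image upper ∪ Finset.univ.image lower, ?_, ?_, ?_⟩
  · have hupper := Finset.card_image_le (s := Finset.univ) (f := upper)
    have hlower := Finset.card_image_le (s := Finset.univ) (f := lower)
    rw [Finset.card_univ, Fintype.card_fin] at hupper hlower
    have := Finset.card_union_le (Finset.univ.image upper) (Finset.univ.image lower)
    omega
  · intro S hS
    simp only [Finset.mem_union, Finset.mem_image, Finset.mem_univ, true_and] at hS
    rcases hS with ⟨i, rfl⟩ | ⟨i, rfl⟩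
    · convert isSplit_coordinate i (2 * n + 1) using 5
      · push_cast; rfl
      · push_cast; ring
    · convert isSplit_coordinate i (-1) using 5 <;> norm_num
  · rintro x ⟨hxP, hxhull⟩
    have hbox : x ∉ Set.Icc (0 : Fin n → ℝ) (fun _ => (2 * n + 1 : ℝ)) := by
      refine fun hx => hxhull (Icc_subset_convexHull_of_vertices (a := 0) (by positivity) ?_ hx)
      refine fun v hv => ⟨⟨fun i => ?_, fun i => ?_⟩, fun i => ?_⟩
      · rcases hv i with h | h <;> simp only [h] <;> linarith [n.cast_nonneg (α := ℝ)]
      · rcases hv i with h | h <;> simp only [h] <;> linarith [n.cast_nonneg (α := ℝ)]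
      · rcases hv i with h | h
        · exact ⟨0, by simp [h]⟩
        · exact ⟨2 * n + 1, by simp [h]⟩
    obtain ⟨i, hi⟩ := Set.mem_iUnion.mp (hcover ⟨hxP, hbox⟩)
    simp only [Set.mem_iUnion, Finset.mem_union, Finset.mem_image, Finset.mem_univ, true_and]
    rcases hi with hi | hi
    · exact ⟨upper i, Or.inl ⟨i, rfl⟩, hi⟩
    · exact ⟨lower i, Or.inr ⟨i, rfl⟩, hi⟩
end

section
/- Let n ≥ 2 and P := [−1/2, 2n + 3/2]^n ⊆ ℝ^n. Every finite collection 𝒮 of split sets in ℝ^n with P \ [0, 2n+1]^n ⊆ ⋃_{S ∈ 𝒮} S has cardinality |𝒮| ≥ 2n. Combined with the explicit cover by 2n split sets, the split cover number of P \ conv(P ∩ ℤ^n) is exactly 2n. -/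
/-- If moving from the integer `m` by `ε * a`, a step of length less than one, leads into the
open interval `(β, β + 1)`, then `m` is the endpoint of the interval opposite to the sign of `a`. -/
theorem eq_endpoint_of_lt_of_lt {β m a : ℤ} {ε : ℝ} (hε : 0 < ε) (ha : ε * |(a : ℝ)| < 1)
    (h₁ : (β : ℝ) < m + ε * a) (h₂ : (m : ℝ) + ε * a < β + 1) :
    (0 < a ∧ β = m) ∨ (a < 0 ∧ β + 1 = m) := by
  rcases lt_trichotomy a 0 with h | rfl | h
  · have h' : (a : ℝ) < 0 := by exact_mod_cast h
    rw [abs_of_neg h'] at ha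
    have hneg : ε * a < 0 := mul_neg_of_pos_of_neg hε h'
    have h₃ : (β : ℝ) < m := by linarith
    have h₄ : (m : ℝ) < β + 2 := by linarith
    norm_cast at h₃ h₄
    right
    omega
  · simp only [Int.cast_zero, mul_zero, add_zero] at h₁ h₂
    norm_cast at h₁ h₂
    omega
  · have h' : (0 : ℝ) < a := by exact_mod_cast h
    rw [abs_of_pos h'] at ha
    have hpos : 0 < ε * a := mul_pos hε h'
    have h₃ : (m : ℝ) < β + 1 := by linarith
    have h₄ : (β : ℝ) < m + 1 := by linarith
    norm_cast at h₃ h₄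
    left
    omega

/-- The affine polynomial `∑ i, a i * X i + c`. -/
noncomputable def affinePolynomial {ι R : Type*} [Fintype ι] [CommRing R] (a : ι → R) (c : R) :
    MvPolynomial ι R :=
  ∑ i, MvPolynomial.C (a i) * MvPolynomial.X i + MvPolynomial.C c

theorem eval_affinePolynomial {ι R : Type*} [Fintype ι] [CommRing R] (a : ι → R) (c : R)
    (z : ι → R) : MvPolynomial.eval z (affinePolynomial a c) = ∑ i, a i * z i + c := by
  simp [affinePolynomial]

theorem totalDegree_affinePolynomial_le {ι R : Type*} [Fintype ι] [CommRing R] [Nontrivial R]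
    (a : ι → R) (c : R) : (affinePolynomial a c).totalDegree ≤ 1 := by
  refine (MvPolynomial.totalDegree_add _ _).trans (max_le ?_ (by simp))
  refine MvPolynomial.totalDegree_finsetSum_le fun i _ => ?_
  refine (MvPolynomial.totalDegree_mul _ _).trans ?_
  simp

theorem affinePolynomial_ne_zero {ι R : Type*} [Fintype ι] [CommRing R]
    {a : ι → R} (ha : a ≠ 0) (c : R) : affinePolynomial a c ≠ 0 := by
  classical
  intro h
  refine ha (funext fun i => ?_)
  have h₀ := eval_affinePolynomial a c 0
  have h₁ := eval_affinePolynomial a c (Pi.single i 1)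
  rw [h] at h₀ h₁
  simp only [map_zero, Pi.zero_apply, mul_zero, Finset.sum_const_zero, zero_add] at h₀
  simpa [Pi.single_apply, ← h₀] using h₁.symm

/-- Fewer than `#A` affine hyperplanes do not cover the grid `A ^ ι`. -/
theorem exists_mem_grid_forall_ne_zero {ι κ R : Type*} [Fintype ι] [CommRing R]
    [IsDomain R] (T : Finset κ) (a : κ → ι → R) (c : κ → R) (ha : ∀ k ∈ T, a k ≠ 0)
    (A : Finset R) (hA : T.card < A.card) :
    ∃ z : ι → R, (∀ i, z i ∈ A) ∧ ∀ k ∈ T, ∑ i, a k i * z i + c k ≠ 0 := by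
  by_contra! H
  have hzero : ∏ k ∈ T, affinePolynomial (a k) (c k) = 0 := by
    refine MvPolynomial.eq_zero_of_eval_zero_at_prod_finset _ (fun _ => A) (fun i => ?_) ?_
    · refine lt_of_le_of_lt ((MvPolynomial.degreeOf_le_totalDegree _ _).trans
        (MvPolynomial.totalDegree_finsetProd _ _)) (lt_of_le_of_lt ?_ hA)
      refine (Finset.sum_le_card_nsmul _ _ 1 fun k _ =>
        totalDegree_affinePolynomial_le _ _).trans ?_
      simp
    · intro z hz
      obtain ⟨k, hk, h⟩ := H z hz
      rw [map_prod]
      exact Finset.prod_eq_zero hk (by rw [eval_affinePolynomial, h])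
  obtain ⟨k, hk, h⟩ := Finset.prod_eq_zero_iff.mp hzero
  exact affinePolynomial_ne_zero (ha k hk) _ h

/-- The outward direction along its axis of a facet of a box; `true` is the upper facet. -/
def facetSign (s : Bool) : ℤ := if s then 1 else -1

/-- The level along its axis of a facet of the box `[0, L] ^ n`. -/
def facetLevel (L : ℕ) (s : Bool) : ℤ := if s then L else 0

/-- If splits cover the layer of width `1 / 2` around `[0, L] ^ n` and there are at most `L` of
them, then every facet of the box has a parallel split bordering it from outside. -/
theorem exists_parallel_split {n L : ℕ} {κ : Type*} (T : Finset κ) (α : κ → Fin n → ℤ)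
    (β : κ → ℤ) (hT : T.card ≤ L)
    (hcover : ∀ x ∈ Set.Icc (fun _ : Fin n => -(1 / 2 : ℝ)) (fun _ => (L + 1 / 2 : ℝ)) \
        Set.Icc (0 : Fin n → ℝ) (fun _ => (L : ℝ)),
      ∃ k ∈ T, (β k : ℝ) < ∑ i, (α k i : ℝ) * x i ∧ ∑ i, (α k i : ℝ) * x i < (β k : ℝ) + 1)
    (i : Fin n) (s : Bool) :
    ∃ k ∈ T, (∀ j ≠ i, α k j = 0) ∧
      ((0 < α k i * facetSign s ∧ β k = α k i * facetLevel L s) ∨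
        (α k i * facetSign s < 0 ∧ β k + 1 = α k i * facetLevel L s)) := by
  classical
  let c : κ → ℤ := fun k => if 0 < α k i * facetSign s then β k else β k + 1
  obtain ⟨z, hzmem, hz⟩ := exists_mem_grid_forall_ne_zero
    (T.filter fun k => ¬ ∀ j ≠ i, α k j = 0) (fun k => Function.update (α k) i 0)
    (fun k => α k i * facetLevel L s - c k)
    (by
      intro k hk h
      refine (Finset.mem_filter.mp hk).2 fun j hj => ?_
      simpa [hj] using congrFun h j)
    (Finset.Icc (0 : ℤ) L)
    (by
      have := Finset.card_filter_le T fun k => ¬ ∀ j ≠ i, α k j = 0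
      simp only [Int.card_Icc]
      omega)
  obtain ⟨M, hM⟩ : ∃ M : ℤ, ∀ k ∈ T, |α k i| ≤ M := by
    obtain ⟨M, hM⟩ := (T.image fun k => |α k i|).bddAbove
    exact ⟨M, fun k hk => hM (Finset.mem_coe.mpr (Finset.mem_image_of_mem _ hk))⟩
  set ε : ℝ := 1 / (|(M : ℝ)| + 2) with hε_def
  have hε : 0 < ε := by positivity
  have hε_le : ε ≤ 1 / 2 := by
    rw [hε_def]
    gcongr
    linarith [abs_nonneg (M : ℝ)]
  have hε_lt : ∀ k ∈ T, ε * |(α k i : ℝ)| < 1 := by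
    intro k hk
    have h : |(α k i : ℝ)| ≤ M := by exact_mod_cast hM k hk
    rw [hε_def, one_div_mul_eq_div, div_lt_one (by positivity)]
    linarith [le_abs_self (M : ℝ)]
  set x : Fin n → ℝ := Function.update (fun j => (z j : ℝ)) i
    (facetLevel L s + ε * facetSign s) with hx_def
  have hxi : x i = facetLevel L s + ε * facetSign s := Function.update_self ..
  have hxj : ∀ j ≠ i, x j = z j := fun j hj => Function.update_of_ne hj ..
  have hzj : ∀ j, (0 : ℝ) ≤ z j ∧ (z j : ℝ) ≤ L := fun j => by
    have := Finset.mem_Icc.mp (hzmem j)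
    exact_mod_cast this
  have hL : (0 : ℝ) ≤ L := Nat.cast_nonneg L
  have hx : x ∈ Set.Icc (fun _ : Fin n => -(1 / 2 : ℝ)) (fun _ => (L + 1 / 2 : ℝ)) \
      Set.Icc (0 : Fin n → ℝ) (fun _ => (L : ℝ)) := by
    have hbox : ∀ j, -(1 / 2 : ℝ) ≤ x j ∧ x j ≤ L + 1 / 2 := by
      intro j
      by_cases hj : j = i
      · subst hj
        rw [hxi]
        cases s <;> simp only [facetLevel, facetSign] <;> constructor <;> norm_num <;> linarith
      · rw [hxj j hj]
        constructor <;> linarith [hzj j]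
    refine ⟨⟨fun j => (hbox j).1, fun j => (hbox j).2⟩, fun h => ?_⟩
    have h₀ := h.1 i
    have h₁ := h.2 i
    simp only [hxi, Pi.zero_apply] at h₀ h₁
    cases s <;> norm_num [facetLevel, facetSign] at h₀ h₁ <;> linarith
  obtain ⟨k, hk, h₁, h₂⟩ := hcover x hx
  set m : ℤ := ∑ j, Function.update (α k) i 0 j * z j + α k i * facetLevel L s with hm
  have hsum : ∑ j, (α k j : ℝ) * x j = m + ε * (α k i * facetSign s : ℤ) := by
    rw [hm, ← Finset.add_sum_erase _ _ (Finset.mem_univ i),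
      ← Finset.add_sum_erase _ _ (Finset.mem_univ i), hxi]
    have : ∑ j ∈ Finset.univ.erase i, (α k j : ℝ) * x j =
        ((∑ j ∈ Finset.univ.erase i, Function.update (α k) i 0 j * z j : ℤ) : ℝ) := by
      push_cast
      refine Finset.sum_congr rfl fun j hj => ?_
      rw [hxj j (Finset.ne_of_mem_erase hj), Function.update_of_ne (Finset.ne_of_mem_erase hj)]
    rw [this]
    simp only [Function.update_self]
    push_cast
    ring
  rw [hsum] at h₁ h₂
  have habs : |((α k i * facetSign s : ℤ) : ℝ)| = |(α k i : ℝ)| := by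
    cases s <;> simp [facetSign]
  have hend := eq_endpoint_of_lt_of_lt hε (by rw [habs]; exact hε_lt k hk) h₁ h₂
  have hpar : ∀ j ≠ i, α k j = 0 := by
    by_contra hnot
    have h := hz k (Finset.mem_filter.mpr ⟨hk, hnot⟩)
    apply h
    have hc : c k = m := by
      rcases hend with ⟨hpos, h⟩ | ⟨hneg, h⟩
      · simp only [c, if_pos hpos, h]
      · simp only [c, if_neg hneg.not_gt, h]
    rw [hc, hm]
    ring
  have hm' : m = α k i * facetLevel L s := by
    rw [hm, Finset.sum_eq_zero, zero_add]
    intro j _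
    by_cases hj : j = i
    · simp [hj]
    · simp [hj, hpar j hj]
  rw [hm'] at hend
  exact ⟨k, hk, hpar, hend⟩

/-- Covering the layer of width `1 / 2` around `[0, L] ^ n` takes at least `2 * n` splits,
provided that `L + 1 ≥ 2 * n`. -/
theorem two_mul_le_card_of_cover {n L : ℕ} {κ : Type*} (T : Finset κ) (α : κ → Fin n → ℤ)
    (β : κ → ℤ) (hα : ∀ k ∈ T, α k ≠ 0) (hL : 2 * n ≤ L + 1)
    (hcover : ∀ x ∈ Set.Icc (fun _ : Fin n => -(1 / 2 : ℝ)) (fun _ => (L + 1 / 2 : ℝ)) \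
        Set.Icc (0 : Fin n → ℝ) (fun _ => (L : ℝ)),
      ∃ k ∈ T, (β k : ℝ) < ∑ i, (α k i : ℝ) * x i ∧ ∑ i, (α k i : ℝ) * x i < (β k : ℝ) + 1) :
    2 * n ≤ T.card := by
  by_contra! hlt
  choose f hfT hf using fun p : Fin n × Bool =>
    exists_parallel_split T α β (by omega) hcover p.1 p.2
  have hinj : Function.Injective f := by
    rintro ⟨i, s⟩ ⟨j, t⟩ h
    obtain ⟨hi, hs⟩ := hf (i, s)
    obtain ⟨hj, ht⟩ := hf (j, t)
    have hne := hα _ (hfT (i, s))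
    rw [← h] at hj ht
    generalize f (i, s) = k at hi hs hj ht hne
    obtain rfl : i = j := by
      by_contra hij
      refine hne (funext fun l => ?_)
      by_cases hl : l = i
      · exact hj l (hl ▸ hij)
      · exact hi l hl
    have hL0 : (0 : ℤ) ≤ L := Int.natCast_nonneg L
    simp only [Prod.mk.injEq, true_and]
    cases s <;> cases t <;> simp only [facetSign, facetLevel] at hs ht ⊢ <;>
      rcases hs with ⟨h₁, h₂⟩ | ⟨h₁, h₂⟩ <;> rcases ht with ⟨h₃, h₄⟩ | ⟨h₃, h₄⟩ <;>
      simp at h₁ h₂ h₃ h₄ <;> nlinarith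
  have hcard := Finset.card_le_card_of_injOn (s := Finset.univ) f (fun p _ => hfT p) hinj.injOn
  simp at hcard
  omega

/-- The box `[0, L] ^ n` is contained in the convex hull of the integer points of any set
containing its vertices. -/
theorem Icc_subset_convexHull_integer_points {n L : ℕ} {P : Set (Fin n → ℝ)}
    (hP : Set.Icc (0 : Fin n → ℝ) (fun _ => (L : ℝ)) ⊆ P) :
    Set.Icc (0 : Fin n → ℝ) (fun _ => (L : ℝ)) ⊆
      convexHull ℝ (P ∩ {x | ∀ i, ∃ m : ℤ, x i = (m : ℝ)}) := by
  have hbox : Set.Icc (0 : Fin n → ℝ) (fun _ => (L : ℝ)) =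
      convexHull ℝ (Set.univ.pi fun _ => ({0, (L : ℝ)} : Set ℝ)) := by
    rw [convexHull_pi, ← Set.pi_univ_Icc]
    simp [convexHull_pair]
  refine hbox.le.trans (convexHull_mono fun x hx => ⟨hP ?_, fun i => ?_⟩)
  · rw [hbox]
    exact subset_convexHull ℝ _ hx
  · rcases hx i (Set.mem_univ i) with h | h
    · exact ⟨0, by simpa using h⟩
    · exact ⟨L, by simpa using h⟩

/-- The split set bordering a facet of `[0, L] ^ n` from outside. -/
def facetSplit {n : ℕ} (L : ℕ) (p : Fin n × Bool) : Set (Fin n → ℝ) :=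
  {x | (if p.2 then (L : ℝ) else -1) < x p.1 ∧ x p.1 < (if p.2 then (L : ℝ) else -1) + 1}

theorem isSplit_facetSplit {n : ℕ} (L : ℕ) (p : Fin n × Bool) : IsSplit (facetSplit L p) := by
  refine ⟨Pi.single p.1 1, if p.2 then L else -1, by simp, ?_⟩
  ext x
  simp [facetSplit, Pi.single_apply]

theorem diff_subset_iUnion_facetSplit (n L : ℕ) :
    Set.Icc (fun _ : Fin n => -(1 / 2 : ℝ)) (fun _ => (L + 1 / 2 : ℝ)) \
      Set.Icc (0 : Fin n → ℝ) (fun _ => (L : ℝ)) ⊆ ⋃ p, facetSplit L p := by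
  rintro x ⟨hx, hx'⟩
  obtain ⟨i, hi⟩ : ∃ i, x i < 0 ∨ (L : ℝ) < x i := by
    by_contra! h
    exact hx' ⟨fun i => (h i).1, fun i => (h i).2⟩
  have h₁ := hx.1 i
  have h₂ := hx.2 i
  simp only at h₁ h₂
  rcases hi with hi | hi
  · refine Set.mem_iUnion.mpr ⟨(i, false), ?_⟩
    constructor <;> simp <;> linarith
  · refine Set.mem_iUnion.mpr ⟨(i, true), ?_⟩
    constructor <;> simp <;> linarith


theorem stmt10 (n : ℕ) (hn : 2 ≤ n) :
    (∀ 𝒮 : Finset (Set (Fin n → ℝ)), (∀ S ∈ 𝒮, IsSplit S) →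
      Set.Icc (fun _ => -(1 / 2 : ℝ)) (fun _ => (2 * n + 3 / 2 : ℝ)) \
          Set.Icc (0 : Fin n → ℝ) (fun _ => (2 * n + 1 : ℝ)) ⊆
        ⋃ S ∈ 𝒮, S →
      2 * n ≤ 𝒮.card) ∧
    (∃ 𝒮 : Finset (Set (Fin n → ℝ)), (∀ S ∈ 𝒮, IsSplit S) ∧
      Set.Icc (fun _ => -(1 / 2 : ℝ)) (fun _ => (2 * n + 3 / 2 : ℝ)) \
          convexHull ℝ
            (Set.Icc (fun _ => -(1 / 2 : ℝ)) (fun _ => (2 * n + 3 / 2 : ℝ)) ∩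
              {x : Fin n → ℝ | ∀ i, ∃ m : ℤ, x i = (m : ℝ)}) ⊆
        (⋃ S ∈ 𝒮, S) ∧
      𝒮.card = 2 * n) := by
  have hlevel : (2 * n + 1 : ℝ) = ((2 * n + 1 : ℕ) : ℝ) := by push_cast; ring
  have hupper : (2 * n + 3 / 2 : ℝ) = ((2 * n + 1 : ℕ) : ℝ) + 1 / 2 := by push_cast; ring
  rw [hlevel, hupper]
  have hlower : ∀ 𝒮 : Finset (Set (Fin n → ℝ)), (∀ S ∈ 𝒮, IsSplit S) →
      Set.Icc (fun _ => -(1 / 2 : ℝ)) (fun _ => ((2 * n + 1 : ℕ) : ℝ) + 1 / 2) \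
          Set.Icc (0 : Fin n → ℝ) (fun _ => ((2 * n + 1 : ℕ) : ℝ)) ⊆
        ⋃ S ∈ 𝒮, S →
      2 * n ≤ 𝒮.card := by
    intro 𝒮 hsplit hcover
    choose α β hα hS using fun S : 𝒮 => hsplit S S.2
    rw [← Finset.card_attach]
    refine two_mul_le_card_of_cover (L := 2 * n + 1) 𝒮.attach α β (fun S _ => hα S)
      (by omega) fun x hx => ?_
    obtain ⟨S, hmem, hxS⟩ := Set.mem_iUnion₂.mp (hcover hx)
    exact ⟨⟨S, hmem⟩, Finset.mem_attach _ _, (hS ⟨S, hmem⟩).le hxS⟩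
  refine ⟨hlower, ?_⟩
  classical
  let 𝒮 : Finset (Set (Fin n → ℝ)) := Finset.univ.image (facetSplit (2 * n + 1))
  have hsplit : ∀ S ∈ 𝒮, IsSplit S := by
    intro S hS
    obtain ⟨p, -, rfl⟩ := Finset.mem_image.mp hS
    exact isSplit_facetSplit _ p
  have hcover := diff_subset_iUnion_facetSplit n (2 * n + 1)
  rw [show ⋃ p, facetSplit (n := n) (2 * n + 1) p = ⋃ S ∈ 𝒮, S by
    simp only [𝒮, Finset.set_biUnion_finset_image, Finset.mem_univ, Set.iUnion_true]] at hcover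
  refine ⟨𝒮, hsplit, (Set.sdiff_subset_sdiff_right ?_).trans hcover,
    le_antisymm (Finset.card_image_le.trans (by simp [mul_comm])) (hlower 𝒮 hsplit hcover)⟩
  exact Icc_subset_convexHull_integer_points
    (Set.Icc_subset_Icc (fun _ => by simp) fun _ => by simp)
end

section
/- Let n ≥ 1, let 0 ≤ ε ≤ 1 and b > 0, and define P(n, b) := {x ∈ ℝ^n : x_i ≥ ε for i = 1, …, n, and Σ_{i=1}^n x_i < nε + b}. Then for every collection 𝒮 of generalized split sets in ℝ^n with |𝒮| ≤ ⌈b⌉ − 1, P(n, b) is not contained in ⋃_{S ∈ 𝒮} S. -/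
/-- An open interval of length one contains at most one multiple of a nonzero integer. -/
lemma eq_of_mul_mem_unit_interval {a : ℤ} (ha : a ≠ 0) {β : ℝ} {j l : ℕ}
    (hj : β < a * j ∧ (a * j : ℝ) < β + 1) (hl : β < a * l ∧ (a * l : ℝ) < β + 1) : j = l := by
  have h1 : a * j < a * l + 1 := by
    have : (a * j : ℝ) < a * l + 1 := by linarith
    exact_mod_cast this
  have h2 : a * l < a * j + 1 := by
    have : (a * l : ℝ) < a * j + 1 := by linarith
    exact_mod_cast this
  have h3 : a * j = a * l := by omega
  exact_mod_cast mul_left_cancel₀ ha h3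

/-- A finite family of `k` generalized splits misses a lattice point of the simplex
`{x : 0 ≤ x, ∑ i, x i ≤ k}`. -/
lemma exists_nat_point_not_mem_splits {ι : Type*} (n : ℕ) (s : Finset ι)
    (α : ι → Fin n → ℤ) (β : ι → ℝ) (hα : ∀ i ∈ s, α i ≠ 0) :
    ∃ x : Fin n → ℕ, ∑ t, x t ≤ s.card ∧
      ∀ i ∈ s, ¬ (β i < ∑ t, (α i t : ℝ) * x t ∧ ∑ t, (α i t : ℝ) * x t < β i + 1) := by
  classical
  induction n generalizing s β with
  | zero => exact ⟨0, by simp, fun i hi => (hα i hi (Subsingleton.elim _ _)).elim⟩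
  | succ n ih =>
    set A := s.filter (fun i => Fin.tail (α i) = 0)
    set B := s.filter (fun i => ¬ Fin.tail (α i) = 0)
    have hAB : A.card + B.card = s.card := Finset.card_filter_add_card_filter_not _
    have hA0 : ∀ i ∈ A, α i 0 ≠ 0 := by
      intro i hi h0
      obtain ⟨his, ht⟩ := Finset.mem_filter.1 hi
      refine hα i his (funext fun t => ?_)
      refine Fin.cases h0 (fun t => congrFun ht t) t
    obtain ⟨j, hj, hjA⟩ : ∃ j ∈ Finset.range (A.card + 1),
        ∀ i ∈ A, ¬ (β i < α i 0 * j ∧ (α i 0 * j : ℝ) < β i + 1) := by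
      by_contra! h
      have : Nonempty ι := (h 0 (by simp)).nonempty
      choose! f hfA hf using h
      obtain ⟨j, hj, l, hl, hne, hfe⟩ := Finset.exists_ne_map_eq_of_card_lt_of_maps_to
        (s := Finset.range (A.card + 1)) (t := A) (f := f) (by simp) hfA
      have h2 := hf l hl
      rw [← hfe] at h2
      exact hne (eq_of_mul_mem_unit_interval (hA0 _ (hfA j hj)) (hf j hj) h2)
    obtain ⟨y, hy, hyB⟩ := ih B (fun i => Fin.tail (α i)) (fun i => β i - α i 0 * j)
      (fun i hi => (Finset.mem_filter.1 hi).2)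
    refine ⟨Fin.cons j y, ?_, fun i hi => ?_⟩
    · rw [Fin.sum_univ_succ]
      simp only [Fin.cons_zero, Fin.cons_succ]
      have := Finset.mem_range.1 hj
      omega
    · rw [Fin.sum_univ_succ]
      simp only [Fin.cons_zero, Fin.cons_succ]
      by_cases ht : Fin.tail (α i) = 0
      · have hz : ∀ t : Fin n, α i t.succ = 0 := fun t => congrFun ht t
        simpa [hz] using hjA i (Finset.mem_filter.2 ⟨hi, ht⟩)
      · rintro ⟨h1, h2⟩
        refine hyB i (Finset.mem_filter.2 ⟨hi, ht⟩) ?_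
        simp only [Fin.tail]
        constructor <;> linarith

theorem stmt11 (n : ℕ) (hn : 1 ≤ n) (ε b : ℝ) (hε0 : 0 ≤ ε) (hε1 : ε ≤ 1)
    (hb : 0 < b) (𝒮 : Finset (Set (Fin n → ℝ))) (hsplit : ∀ S ∈ 𝒮, IsGSplit S)
    (hcard : (𝒮.card : ℤ) ≤ ⌈b⌉ - 1) :
    ¬ ({x : Fin n → ℝ | (∀ i, ε ≤ x i) ∧ ∑ i, x i < n * ε + b} ⊆
        ⋃ S ∈ 𝒮, S) := by
  intro hsub
  choose! α β hα hS using hsplit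
  obtain ⟨y, hy, hyS⟩ := exists_nat_point_not_mem_splits n 𝒮 α
    (fun S => β S - ∑ t, (α S t : ℝ) * ε) hα
  have hkb : (𝒮.card : ℝ) < b := by
    have h : (𝒮.card : ℤ) < ⌈b⌉ := by omega
    exact_mod_cast Int.lt_ceil.1 h
  have hy' : ∑ t, (y t : ℝ) ≤ 𝒮.card := by exact_mod_cast hy
  have hmem := hsub (show (fun t => ε + (y t : ℝ)) ∈ _ from
    ⟨fun t => by simp, by simp only [Finset.sum_add_distrib]; simp; linarith⟩)
  simp only [Set.mem_iUnion] at hmem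
  obtain ⟨S, hS𝒮, hxS⟩ := hmem
  rw [hS S hS𝒮] at hxS
  simp only [Set.mem_ofPred_eq, mul_add, Finset.sum_add_distrib] at hxS
  exact hyS S hS𝒮 ⟨by linarith [hxS.1], by linarith [hxS.2]⟩
end

section
/- Let n ≥ 1 and define P' := {x ∈ ℝ^n : x_i ≥ 1/(2n) for i = 1, …, n, and Σ_{i=1}^n x_i < n}. Then every collection 𝒮 of split sets in ℝ^n with P' ⊆ ⋃_{S ∈ 𝒮} S has cardinality |𝒮| ≥ n; that is, the split cover number of P' is at least n. -/
/-- Fewer than `n` linear forms on `ℝ^n` have a common nonzero zero. -/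
theorem exists_ne_zero_forall_sum_mul_eq_zero {n : ℕ} {ι : Type*} [Fintype ι]
    (h : Fintype.card ι < n) (a : ι → Fin n → ℝ) :
    ∃ d : Fin n → ℝ, d ≠ 0 ∧ ∀ j, ∑ i, a j i * d i = 0 := by
  have hker : LinearMap.ker (Matrix.mulVecLin (Matrix.of a)) ≠ ⊥ :=
    LinearMap.ker_ne_bot_of_finrank_lt (by simpa using h)
  obtain ⟨d, hd, hd0⟩ := (Submodule.ne_bot_iff _).1 hker
  exact ⟨d, hd0, fun j => congrFun (LinearMap.mem_ker.1 hd) j⟩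

/-- Every line through the origin has a translate by an integer vector that meets the set
`{x | (∀ i, 1 / (2 * n) ≤ x i) ∧ ∑ i, x i < n}`. -/
theorem exists_smul_sub_int_mem {n : ℕ} {d : Fin n → ℝ} (hd : d ≠ 0) :
    ∃ (t : ℝ) (m : Fin n → ℤ), (∀ i, 1 / (2 * n) ≤ t * d i - m i) ∧
      ∑ i, (t * d i - m i) < n := by
  obtain ⟨k, hk⟩ := Function.ne_iff.1 hd
  rw [Pi.zero_apply] at hk
  have hn : (1 : ℝ) ≤ n := by exact_mod_cast k.pos
  have htk : 1 / (2 * d k) * d k = 1 / 2 := by field_simp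
  set t : ℝ := 1 / (2 * d k)
  set c : ℝ := 1 / (2 * n) with hc
  have hc0 : 0 < c := by positivity
  have hnc : n * c = 1 / 2 := by rw [hc]; field_simp
  have hc2 : c ≤ 1 / 2 := by nlinarith
  have hfloor : ⌊t * d k - c⌋ = 0 := by
    rw [htk, Int.floor_eq_zero_iff]
    constructor <;> linarith
  refine ⟨t, fun i => ⌊t * d i - c⌋, fun i => ?_, ?_⟩
  · linarith [Int.floor_le (t * d i - c)]
  · rw [← Finset.add_sum_erase _ _ (Finset.mem_univ k)]
    beta_reduce
    rw [hfloor, htk]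
    have hsum := Finset.sum_le_card_nsmul (Finset.univ.erase k)
      (fun i => t * d i - (⌊t * d i - c⌋ : ℝ)) (1 + c)
      (fun i _ => by linarith [Int.lt_floor_add_one (t * d i - c)])
    rw [Finset.card_erase_of_mem (Finset.mem_univ k), Finset.card_univ, Fintype.card_fin,
      nsmul_eq_mul, Nat.cast_sub k.pos] at hsum
    push_cast at hsum ⊢
    nlinarith

theorem stmt12 (n : ℕ) (hn : 1 ≤ n) (𝒮 : Finset (Set (Fin n → ℝ)))
    (hsplit : ∀ S ∈ 𝒮, IsSplit S)
    (hcover : {x : Fin n → ℝ | (∀ i, 1 / (2 * n) ≤ x i) ∧ ∑ i, x i < n} ⊆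
      ⋃ S ∈ 𝒮, S) :
    n ≤ 𝒮.card := by
  by_contra! hlt
  choose α β _ hS using fun S : 𝒮 => hsplit S S.2
  obtain ⟨d, hd, hαd⟩ := exists_ne_zero_forall_sum_mul_eq_zero
    (by simpa using hlt) (fun (S : 𝒮) i => (α S i : ℝ))
  obtain ⟨t, m, hlow, hsum⟩ := exists_smul_sub_int_mem hd
  obtain ⟨S, hS𝒮, hxS⟩ := Set.mem_iUnion₂.1
    (hcover (show (fun i => t * d i - m i) ∈ _ from ⟨hlow, hsum⟩))
  have hval : ∑ i, (α ⟨S, hS𝒮⟩ i : ℝ) * (t * d i - m i) =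
      ((-∑ i, α ⟨S, hS𝒮⟩ i * m i : ℤ) : ℝ) := by
    have h := hαd ⟨S, hS𝒮⟩
    push_cast
    simp only [mul_sub, Finset.sum_sub_distrib, mul_left_comm _ t, ← Finset.mul_sum, h]
    ring
  rw [show S = _ from hS ⟨S, hS𝒮⟩, Set.mem_ofPred_eq, hval] at hxS
  obtain ⟨h₁, h₂⟩ := hxS
  norm_cast at h₁ h₂
  omega
end
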